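/- arXiv:2605.24146 — 2 statements merged into one kernel-verified Lean document; each statement's English description precedes it below -/
import Mathlib

section
/- Let p be a prime, s ≥ 1, and P(x,y) ∈ F̄_p[x,y] an absolutely irreducible polynomial (irreducible over the algebraic closure F̄_p) of bidegree (d_1, d_2) with d_2 ≥ 1, such that P(0,0) ≠ 0 and deg_x P(x,0) ≥ 1. Let G be a subgroup of F_{p^s}^* with 10^3 < |G| < (1/3)·p^{3/4}. Then the number of pairs (x,y) ∈ G × G with P(x,y) = 0 is at most 12·d_1·d_2·(d_1 + d_2)^2·|G|^{2/3}. -/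
/-- The algebraic closure of the prime field `𝔽_p`. -/
abbrev Fpbar (p : ℕ) [Fact p.Prime] : Type := AlgebraicClosure (ZMod p)

section SparsePolynomials

open Polynomial

/-- A nonzero polynomial of degree less than the characteristic vanishes at a nonzero point to
order less than its number of terms. -/
lemma not_X_sub_C_pow_card_support_dvd {K : Type*} [Field K] {p : ℕ} [CharP K p] {x₀ : K}
    (hx₀ : x₀ ≠ 0) {Q : K[X]} (hQ : Q ≠ 0) (hdeg : Q.natDegree < p) :
    ¬ (X - C x₀) ^ Q.support.card ∣ Q := by
  obtain ⟨k, hk⟩ : ∃ k, Q.support.card = k + 1 :=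
    Nat.exists_eq_succ_of_ne_zero (by simpa using hQ)
  induction k generalizing Q with
  | zero =>
    intro h
    rw [hk, zero_add, pow_one, dvd_iff_isRoot] at h
    obtain ⟨e, c, hc, rfl⟩ := card_support_eq_one.mp hk
    simp [hc, hx₀] at h
  | succ k ih =>
    intro h
    set T : K[X] := X * derivative Q - C (Q.natDegree : K) * Q with hT
    have hcoeff : ∀ e, T.coeff e = ((e : K) - Q.natDegree) * Q.coeff e := by
      intro e
      rw [hT, coeff_sub, coeff_C_mul]
      cases e with
      | zero => simp
      | succ e => rw [coeff_X_mul, coeff_derivative]; push_cast; ring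
    have hsupp : T.support = Q.support.erase Q.natDegree := by
      ext e
      rw [mem_support_iff, hcoeff, Finset.mem_erase, mem_support_iff]
      by_cases he : Q.coeff e = 0
      · simp [he]
      · have hle := le_natDegree_of_ne_zero he
        have : ((e : K) - Q.natDegree = 0) ↔ e = Q.natDegree := by
          rw [sub_eq_zero, (CharP.natCast_eq_natCast K p).trans
            ⟨fun h => Nat.ModEq.eq_of_lt_of_lt h (by omega) (by omega), fun h => h ▸ rfl⟩]
        simp [he, this]
    have hcard : T.support.card = k + 1 := by
      rw [hsupp, Finset.card_erase_of_mem (natDegree_mem_support_of_nonzero hQ), hk]; rfl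
    have hT0 : T ≠ 0 := by
      intro h0
      simp [h0] at hcard
    refine ih hT0 ?_ hcard ?_
    · refine lt_of_le_of_lt (natDegree_le_iff_coeff_eq_zero.mpr fun e he => ?_) hdeg
      rw [hcoeff, coeff_eq_zero_of_natDegree_lt he, mul_zero]
    · rw [hcard]
      rw [hk] at h
      refine dvd_sub (Dvd.dvd.mul_left ?_ _) (Dvd.dvd.mul_left (dvd_trans (pow_dvd_pow _ ?_) h) _)
      · simpa using pow_sub_one_dvd_derivative_of_pow_dvd h
      · omega

/-- The number of points at which a nonzero polynomial vanishes to order at least `M`. -/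
lemma card_mul_le_natDegree {K : Type*} [Field K] {R : K[X]} (hR : R ≠ 0) (S : Finset K) (M : ℕ)
    (hS : ∀ x ∈ S, (X - C x) ^ M ∣ R) : S.card * M ≤ R.natDegree := by
  have hdvd : ∏ x ∈ S, (X - C x) ^ M ∣ R :=
    Finset.prod_dvd_of_coprime (fun x _ y _ hxy =>
      (pairwise_coprime_X_sub_C Function.injective_id hxy).pow) hS
  have := natDegree_le_of_dvd hdvd hR
  rwa [natDegree_prod _ _ fun x _ => pow_ne_zero _ (X_sub_C_ne_zero x),
    Finset.sum_congr rfl fun x _ => by rw [natDegree_pow, natDegree_X_sub_C, mul_one],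
    Finset.sum_const, smul_eq_mul] at this

end SparsePolynomials

section Derivations

variable {K S T : Type*} [CommRing K] [CommRing S] [Algebra K S] [CommRing T]

lemma map_iterate_derivation_mul_eq_zero (δ : Derivation K S S) (ev : S →+* T) (M : ℕ) (V F : S)
    (hF : ∀ k < M, ev (δ^[k] F) = 0) : ∀ k < M, ev (δ^[k] (V * F)) = 0 := by
  induction M generalizing V F with
  | zero => simp
  | succ M ih =>
    intro k hk
    cases k with
    | zero =>
      have h0 : ev F = 0 := hF 0 (by omega)
      simp [h0]
    | succ k =>
      have h1 := ih V (δ F) (fun j hj => by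
        simpa [Function.iterate_succ_apply] using hF (j + 1) (by omega)) k (by omega)
      have h2 := ih (δ V) F (fun j hj => hF j (by omega)) k (by omega)
      rw [Function.iterate_succ_apply, Derivation.leibniz, smul_eq_mul, smul_eq_mul,
        iterate_map_add, map_add, h1, mul_comm F, h2, add_zero]

lemma map_iterate_derivation_pow_mul (δ : Derivation K S S) (ev : S →+* T) {u : S} (hu : ev u = 0)
    (m : ℕ) (r : S) :
    ev (δ^[m] (u ^ m * r)) = m.factorial * ev (δ u) ^ m * ev r := by
  induction m generalizing r with
  | zero => simp
  | succ m ih =>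
    have : δ (u ^ (m + 1) * r) = u ^ m * ((m + 1) * δ u * r + u * δ r) := by
      rw [Derivation.leibniz, Derivation.leibniz_pow]
      simp only [smul_eq_mul, nsmul_eq_mul, Nat.add_sub_cancel]
      push_cast
      ring
    rw [Function.iterate_succ_apply, this, ih, Nat.factorial_succ]
    simp only [map_add, map_mul, hu, map_natCast, map_one]
    push_cast
    ring

end Derivations

section Bidegree

open MvPolynomial

variable {K : Type*} [Field K]

variable (K) in
/-- Bivariate polynomials with `deg_x < a` and `deg_y < b`. -/
noncomputable def bidegreeLT (a b : ℕ) : Submodule K (MvPolynomial (Fin 2) K) :=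
  restrictSupport K {m | m 0 < a ∧ m 1 < b}

lemma mem_bidegreeLT {a b : ℕ} {F : MvPolynomial (Fin 2) K} :
    F ∈ bidegreeLT K a b ↔ ∀ m ∈ F.support, m 0 < a ∧ m 1 < b :=
  Iff.rfl

/-- Pairs of exponents below `(a, b)` as finitely supported functions. -/
noncomputable def exponentEquiv (a b : ℕ) :
    {m : Fin 2 →₀ ℕ | m 0 < a ∧ m 1 < b} ≃ Fin a × Fin b where
  toFun m := (⟨m.1 0, m.2.1⟩, ⟨m.1 1, m.2.2⟩)
  invFun e := ⟨Finsupp.equivFunOnFinite.symm ![e.1, e.2], by simp⟩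
  left_inv m := by
    ext i
    fin_cases i <;> simp
  right_inv e := by simp

/-- The monomial basis of `bidegreeLT`. -/
noncomputable def bidegreeLTBasis (a b : ℕ) :
    Module.Basis (Fin a × Fin b) K (bidegreeLT K a b) :=
  (basisRestrictSupport K {m : Fin 2 →₀ ℕ | m 0 < a ∧ m 1 < b}).reindex (exponentEquiv a b)

instance (a b : ℕ) : FiniteDimensional K (bidegreeLT K a b) :=
  (bidegreeLTBasis a b).finiteDimensional_of_finite

lemma finrank_bidegreeLT (a b : ℕ) : Module.finrank K (bidegreeLT K a b) = a * b := by
  simp [Module.finrank_eq_card_basis (bidegreeLTBasis (K := K) a b)]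

lemma mem_bidegreeLT_of_degreeOf {a b : ℕ} {F : MvPolynomial (Fin 2) K}
    (h0 : F.degreeOf 0 < a) (h1 : F.degreeOf 1 < b) : F ∈ bidegreeLT K a b := fun _ hm =>
  ⟨(monomial_le_degreeOf 0 hm).trans_lt h0, (monomial_le_degreeOf 1 hm).trans_lt h1⟩

lemma mul_mem_bidegreeLT {a b c d : ℕ} {F G : MvPolynomial (Fin 2) K} (hF : F ∈ bidegreeLT K a b)
    (h0 : G.degreeOf 0 ≤ c) (h1 : G.degreeOf 1 ≤ d) : F * G ∈ bidegreeLT K (a + c) (b + d) := by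
  classical
  rw [mem_bidegreeLT] at hF ⊢
  intro m hm
  obtain ⟨m₁, hm₁, m₂, hm₂, rfl⟩ := Finset.mem_add.mp (support_mul F G hm)
  have := hF m₁ hm₁
  have := (monomial_le_degreeOf 0 hm₂).trans h0
  have := (monomial_le_degreeOf 1 hm₂).trans h1
  simp only [Finsupp.add_apply]
  omega

lemma bidegreeLT_mono {a b a' b' : ℕ} (ha : a ≤ a') (hb : b ≤ b') :
    bidegreeLT K a b ≤ bidegreeLT K a' b' :=
  restrictSupport_mono K fun _ hm => ⟨hm.1.trans_le ha, hm.2.trans_le hb⟩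

/-- Linear algebra: a family of `M`-tuples of polynomials with enough members has a nontrivial
combination divisible by `P` in every entry. -/
lemma exists_linearCombination_dvd {ι : Type*} [Fintype ι] {P : MvPolynomial (Fin 2) K}
    (hP : P ≠ 0) {a b M : ℕ} (ha : P.degreeOf 0 ≤ a) (hb : P.degreeOf 1 ≤ b)
    (f : ι → Fin M → MvPolynomial (Fin 2) K) (hf : ∀ i k, f i k ∈ bidegreeLT K a b)
    (hcard : M * (a * b) <
      Fintype.card ι + M * ((a - P.degreeOf 0) * (b - P.degreeOf 1))) :
    ∃ c : ι → K, c ≠ 0 ∧ ∀ k, P ∣ ∑ i, c i • f i k := by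
  have hmul (G : bidegreeLT K (a - P.degreeOf 0) (b - P.degreeOf 1)) :
      (G : MvPolynomial (Fin 2) K) * P ∈ bidegreeLT K a b := by
    have := mul_mem_bidegreeLT G.2 (le_refl (P.degreeOf 0)) (le_refl (P.degreeOf 1))
    rwa [Nat.sub_add_cancel ha, Nat.sub_add_cancel hb] at this
  let φ : (ι → K) →ₗ[K] Fin M → bidegreeLT K a b :=
    Fintype.linearCombination K fun i k => ⟨f i k, hf i k⟩
  let ψ : bidegreeLT K (a - P.degreeOf 0) (b - P.degreeOf 1) →ₗ[K] bidegreeLT K a b :=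
    ((LinearMap.mulRight K P).comp (Submodule.subtype _)).codRestrict _ hmul
  let Φ : (ι → K) × (Fin M → bidegreeLT K (a - P.degreeOf 0) (b - P.degreeOf 1)) →ₗ[K]
      Fin M → bidegreeLT K a b :=
    φ.coprod (LinearMap.pi fun k => ψ.comp (LinearMap.proj k))
  have hker : LinearMap.ker Φ ≠ ⊥ := LinearMap.ker_ne_bot_of_finrank_lt (by
    simpa [finrank_bidegreeLT, Module.finrank_pi_fintype] using hcard)
  obtain ⟨⟨c, G⟩, hmem, hne⟩ := Submodule.exists_mem_ne_zero_of_ne_bot hker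
  have hzero (k : Fin M) : ∑ i, c i • f i k + (G k : MvPolynomial (Fin 2) K) * P = 0 := by
    have := congrArg Subtype.val (congrFun (LinearMap.mem_ker.mp hmem) k)
    simp only [Φ, φ, Fintype.linearCombination_apply, LinearMap.coprod_apply, Pi.add_apply,
      Finset.sum_apply, Pi.smul_apply, Submodule.coe_add, Submodule.coe_sum,
      Submodule.coe_smul] at this
    exact this
  refine ⟨c, ?_, fun k => ⟨-(G k : MvPolynomial (Fin 2) K), by linear_combination hzero k⟩⟩
  rintro rfl
  refine hne (Prod.ext rfl (funext fun k => Subtype.ext ?_))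
  simpa [hP] using hzero k

lemma natDegree_aeval_X_C_le (c : K) (F : MvPolynomial (Fin 2) K) :
    (aeval ![(Polynomial.X : Polynomial K), Polynomial.C c] F).natDegree ≤ F.degreeOf 0 := by
  rw [aeval_def, eval₂_eq']
  refine Polynomial.natDegree_sum_le_of_forall_le _ _ fun m hm => ?_
  refine le_trans ?_ (monomial_le_degreeOf 0 hm)
  simp only [Fin.prod_univ_two, Polynomial.algebraMap_eq, Matrix.cons_val_zero,
    Matrix.cons_val_one, ← Polynomial.C_pow]
  refine (Polynomial.natDegree_C_mul_le _ _).trans ?_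
  exact (Polynomial.natDegree_mul_C_le _ _).trans (Polynomial.natDegree_X_pow_le _)

lemma natDegree_aeval_C_X_le (c : K) (F : MvPolynomial (Fin 2) K) :
    (aeval ![Polynomial.C c, (Polynomial.X : Polynomial K)] F).natDegree ≤ F.degreeOf 1 := by
  rw [aeval_def, eval₂_eq']
  refine Polynomial.natDegree_sum_le_of_forall_le _ _ fun m hm => ?_
  refine le_trans ?_ (monomial_le_degreeOf 1 hm)
  simp only [Fin.prod_univ_two, Polynomial.algebraMap_eq, Matrix.cons_val_zero,
    Matrix.cons_val_one, ← Polynomial.C_pow]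
  refine (Polynomial.natDegree_C_mul_le _ _).trans ?_
  exact (Polynomial.natDegree_C_mul_le _ _).trans (Polynomial.natDegree_X_pow_le _)

lemma aeval_X_zero_of_degreeOf_one_eq_zero {F : MvPolynomial (Fin 2) K}
    (hF : ∀ m ∈ F.support, m 1 = 0) :
    Polynomial.aeval (X 0 : MvPolynomial (Fin 2) K)
      (aeval ![(Polynomial.X : Polynomial K), Polynomial.C 0] F) = F := by
  conv_rhs => rw [F.as_sum]
  rw [aeval_def, eval₂_eq', map_sum]
  refine Finset.sum_congr rfl fun m hm => ?_
  rw [monomial_eq]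
  simp [Fin.prod_univ_two, hF m hm, algebraMap_eq, Finsupp.prod_fintype]

/-- Elimination of `y` between an irreducible polynomial `P` and a polynomial not divisible by
it, with the degree bound of the resultant. -/
lemma exists_elimination {P F : MvPolynomial (Fin 2) K} (hP : Irreducible P) (hPF : ¬ P ∣ F)
    (hPy : 1 ≤ P.degreeOf 1) {m n : ℕ} (hFx : F.degreeOf 0 ≤ m) (hFy : F.degreeOf 1 ≤ n) :
    ∃ R : Polynomial K, R ≠ 0 ∧ R.natDegree ≤ n * P.degreeOf 0 + P.degreeOf 1 * m ∧
      ∃ U V, Polynomial.aeval (X 0 : MvPolynomial (Fin 2) K) R = U * P + V * F := by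
  set d₁ := P.degreeOf 0 with hd₁
  set d₂ := P.degreeOf 1 with hd₂
  set E := n * d₁ + d₂ * m with hE
  let L : bidegreeLT K (E + 1 - d₁) n × bidegreeLT K (E + 1 - m) d₂ →ₗ[K]
      MvPolynomial (Fin 2) K :=
    ((LinearMap.mulRight K P).comp (Submodule.subtype _)).coprod
      ((LinearMap.mulRight K F).comp (Submodule.subtype _))
  let Φ : bidegreeLT K (E + 1 - d₁) n × bidegreeLT K (E + 1 - m) d₂ →ₗ[K]
      (Fin (E + 1) × Fin (n + d₂ - 1) → K) :=
    LinearMap.pi fun e =>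
      (lcoeff K (Finsupp.equivFunOnFinite.symm ![(e.1 : ℕ), (e.2 : ℕ) + 1])).comp L
  have hm : m ≤ E := by nlinarith
  have hdim : (E + 1) * (n + d₂ - 1) < (E + 1 - d₁) * n + (E + 1 - m) * d₂ := by
    obtain ⟨e, he⟩ : ∃ e, d₂ = e + 1 := ⟨d₂ - 1, by omega⟩
    rcases Nat.eq_zero_or_pos n with rfl | hn
    · obtain ⟨g, hg⟩ : ∃ g, E = m + g := ⟨E - m, by omega⟩
      rw [show E + 1 - m = g + 1 by omega, show 0 + d₂ - 1 = e by omega, he]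
      rw [he] at hE
      nlinarith
    · have : d₁ ≤ E := by nlinarith
      zify [show d₁ ≤ E + 1 by omega, show m ≤ E + 1 by omega, show 1 ≤ n + d₂ by omega]
      zify at hE
      nlinarith
  have hker : LinearMap.ker Φ ≠ ⊥ := LinearMap.ker_ne_bot_of_finrank_lt (by
    simpa [finrank_bidegreeLT] using hdim)
  obtain ⟨⟨U, V⟩, hmem, hne⟩ := Submodule.exists_mem_ne_zero_of_ne_bot hker
  have hU := U.2
  have hV := V.2
  set G : MvPolynomial (Fin 2) K := U * P + V * F with hG
  have hGmem : G ∈ bidegreeLT K (E + 1) (n + d₂) := by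
    refine add_mem ?_ ?_
    · rcases Nat.eq_zero_or_pos n with rfl | hn
      · have : (U : MvPolynomial (Fin 2) K) = 0 := by
          rw [← support_eq_empty, Finset.eq_empty_iff_forall_notMem]
          intro x hx
          exact absurd (mem_bidegreeLT.mp hU x hx).2 (by simp)
        simp [this]
      · have : d₁ ≤ E := by nlinarith
        refine bidegreeLT_mono ?_ le_rfl (mul_mem_bidegreeLT hU hd₁.ge hd₂.ge)
        omega
    · refine bidegreeLT_mono ?_ ?_ (mul_mem_bidegreeLT hV hFx hFy) <;> omega
  have hG1 : ∀ x ∈ G.support, x 1 = 0 := by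
    intro x hx
    by_contra hx1
    obtain ⟨hx0, hx1'⟩ := mem_bidegreeLT.mp hGmem x hx
    have hzero : coeff (Finsupp.equivFunOnFinite.symm ![x 0, x 1 - 1 + 1]) G = 0 :=
      congrFun (LinearMap.mem_ker.mp hmem) (⟨x 0, hx0⟩, ⟨x 1 - 1, by omega⟩)
    have hexp : Finsupp.equivFunOnFinite.symm ![x 0, x 1 - 1 + 1] = x := by
      ext i
      fin_cases i
      · simp
      · simp; omega
    exact mem_support_iff.mp hx (hexp ▸ hzero)
  have hR := aeval_X_zero_of_degreeOf_one_eq_zero hG1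
  have hVdvd : P ∣ (V : MvPolynomial (Fin 2) K) → (V : MvPolynomial (Fin 2) K) = 0 := by
    rintro ⟨W, hW⟩
    by_contra hV0
    have hW0 : W ≠ 0 := by rintro rfl; simp [hW] at hV0
    have h1 := degreeOf_mul_eq (n := 1) hP.ne_zero hW0
    rw [← hW, ← hd₂] at h1
    obtain ⟨e, he⟩ : ∃ e, d₂ = e + 1 := ⟨d₂ - 1, by omega⟩
    have := degreeOf_le_iff.mpr fun x hx =>
      Nat.le_sub_one_of_lt (mem_bidegreeLT.mp hV x hx).2
    omega
  have hG0 : G ≠ 0 := by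
    intro h0
    have hdvd : P ∣ (V : MvPolynomial (Fin 2) K) * F :=
      ⟨-U, by linear_combination h0 - hG⟩
    have hV0 := hVdvd ((hP.prime.dvd_or_dvd hdvd).resolve_right hPF)
    have hU0 : (U : MvPolynomial (Fin 2) K) = 0 := by
      have : (U : MvPolynomial (Fin 2) K) * P = 0 := by
        rw [hV0, zero_mul, add_zero] at hG
        rw [← hG, h0]
      exact (mul_eq_zero.mp this).resolve_right hP.ne_zero
    exact hne (Prod.ext (Subtype.ext hU0) (Subtype.ext hV0))
  refine ⟨_, ?_, ?_, U, V, hR⟩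
  · intro h0
    rw [h0, map_zero] at hR
    exact hG0 hR.symm
  · refine (natDegree_aeval_X_C_le 0 G).trans (degreeOf_le_iff.mpr fun x hx => ?_)
    exact Nat.lt_succ_iff.mp (mem_bidegreeLT.mp hGmem x hx).1

end Bidegree

section CurveDerivation

open MvPolynomial

variable {K : Type*} [Field K]

lemma coeff_X_mul_pderiv (i : Fin 2) (F : MvPolynomial (Fin 2) K) (m : Fin 2 →₀ ℕ) :
    coeff m (X i * pderiv i F) = m i * coeff m F := by
  classical
  induction F using MvPolynomial.induction_on' with
  | add F G hF hG => simp [mul_add, hF, hG]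
  | monomial n a =>
    rw [X_mul_pderiv_monomial, coeff_smul, coeff_monomial]
    split_ifs with h
    · simp [h]
    · simp

lemma degreeOf_X_mul_pderiv_le (i j : Fin 2) (F : MvPolynomial (Fin 2) K) :
    degreeOf j (X i * pderiv i F) ≤ degreeOf j F := by
  refine degreeOf_le_iff.mpr fun m hm => monomial_le_degreeOf j (mem_support_iff.mpr fun h => ?_)
  rw [mem_support_iff, coeff_X_mul_pderiv, h, mul_zero] at hm
  exact hm rfl

/-- The derivation `xy (P_y ∂_x - P_x ∂_y)`, tangent to the curve `P = 0`. -/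
noncomputable def curveDerivation (P : MvPolynomial (Fin 2) K) :
    Derivation K (MvPolynomial (Fin 2) K) (MvPolynomial (Fin 2) K) :=
  (X 0 * X 1 * pderiv 1 P) • pderiv 0 - (X 0 * X 1 * pderiv 0 P) • pderiv 1

lemma curveDerivation_apply (P F : MvPolynomial (Fin 2) K) :
    curveDerivation P F = (X 0 * pderiv 0 F) * (X 1 * pderiv 1 P) -
      (X 1 * pderiv 1 F) * (X 0 * pderiv 0 P) := by
  simp only [curveDerivation, Derivation.sub_apply, Derivation.smul_apply, smul_eq_mul]
  ring

lemma curveDerivation_self (P : MvPolynomial (Fin 2) K) : curveDerivation P P = 0 := by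
  rw [curveDerivation_apply]
  ring

/-- The polynomial `R` with `δ^k (x^i y^j) = x^i y^j R`, where `δ = curveDerivation P`. -/
noncomputable def monomialCofactor (P : MvPolynomial (Fin 2) K) (i j : ℕ) :
    ℕ → MvPolynomial (Fin 2) K
  | 0 => 1
  | k + 1 => curveDerivation P (monomialCofactor P i j k) + monomialCofactor P i j k *
      (C (i : K) * (X 1 * pderiv 1 P) - C (j : K) * (X 0 * pderiv 0 P))

lemma X_mul_pderiv_X_pow (i : Fin 2) (n : ℕ) :
    (X i * pderiv i (X i ^ n) : MvPolynomial (Fin 2) K) = C (n : K) * X i ^ n := by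
  cases n with
  | zero => simp
  | succ n =>
    simp only [pderiv_pow, pderiv_X_self, Nat.add_sub_cancel, map_natCast]
    ring

lemma iterate_curveDerivation_monomial (P : MvPolynomial (Fin 2) K) (i j k : ℕ) :
    (curveDerivation P)^[k] (X 0 ^ i * X 1 ^ j) = X 0 ^ i * X 1 ^ j * monomialCofactor P i j k := by
  induction k with
  | zero => simp [monomialCofactor]
  | succ k ih =>
    have h0 : curveDerivation P (X 0 ^ i) = X 0 ^ i * (C (i : K) * (X 1 * pderiv 1 P)) := by
      rw [curveDerivation_apply, X_mul_pderiv_X_pow]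
      simp
      ring
    have h1 : curveDerivation P (X 1 ^ j) = -(X 1 ^ j * (C (j : K) * (X 0 * pderiv 0 P))) := by
      rw [curveDerivation_apply, X_mul_pderiv_X_pow]
      simp
      ring
    rw [Function.iterate_succ_apply', ih, Derivation.leibniz, Derivation.leibniz, h0, h1,
      monomialCofactor]
    simp only [smul_eq_mul]
    ring

lemma degreeOf_monomialCofactor_le (P : MvPolynomial (Fin 2) K) (i j k : ℕ) (l : Fin 2) :
    degreeOf l (monomialCofactor P i j k) ≤ k * degreeOf l P := by
  induction k with
  | zero => simp [monomialCofactor]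
  | succ k ih =>
    have hle (a b : Fin 2) : degreeOf l (X a * pderiv a (monomialCofactor P i j k) *
        (X b * pderiv b P)) ≤ (k + 1) * degreeOf l P := by
      refine (degreeOf_mul_le _ _ _).trans ?_
      have h1 := (degreeOf_X_mul_pderiv_le a l (monomialCofactor P i j k)).trans ih
      have h2 := degreeOf_X_mul_pderiv_le b l P
      linarith
    rw [monomialCofactor, curveDerivation_apply]
    refine (degreeOf_add_le _ _ _).trans (max_le ?_ ?_)
    · exact (degreeOf_sub_le _ _ _).trans (max_le (hle 0 1) (hle 1 0))
    · refine (degreeOf_mul_le _ _ _).trans ?_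
      have h := (degreeOf_sub_le l (C (i : K) * (X 1 * pderiv 1 P))
        (C (j : K) * (X 0 * pderiv 0 P))).trans (max_le
          ((degreeOf_C_mul_le _ _ _).trans (degreeOf_X_mul_pderiv_le 1 l P))
          ((degreeOf_C_mul_le _ _ _).trans (degreeOf_X_mul_pderiv_le 0 l P)))
      linarith

lemma degreeOf_pderiv_le (i j : Fin 2) (F : MvPolynomial (Fin 2) K) :
    degreeOf j (pderiv i F) ≤ degreeOf j F := by
  refine degreeOf_le_iff.mpr fun m hm => ?_
  rw [mem_support_iff, coeff_pderiv] at hm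
  have := monomial_le_degreeOf j (mem_support_iff.mpr (left_ne_zero_of_mul hm))
  exact le_trans (by simp) this

lemma not_dvd_pderiv_one {p : ℕ} [CharP K p] {P : MvPolynomial (Fin 2) K}
    (hPy : 1 ≤ P.degreeOf 1) (hp : P.degreeOf 1 < p) : ¬ P ∣ pderiv 1 P := by
  have hP0 : P ≠ 0 := ne_zero_of_degreeOf_ne_zero (i := 1) (by omega)
  have hne : pderiv 1 P ≠ 0 := by
    intro h
    have hX := degreeOf_eq_sup 1 P
    obtain ⟨m, hm, hm1⟩ := Finset.exists_mem_eq_sup P.support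
      (support_nonempty.mpr hP0) (fun m => m 1)
    have := coeff_X_mul_pderiv 1 P m
    rw [h, mul_zero, coeff_zero, eq_comm, mul_eq_zero, ← hm1, ← hX, CharP.cast_eq_zero_iff K p]
      at this
    rcases this with h | h
    · exact absurd (Nat.le_of_dvd (by omega) h) (by omega)
    · exact mem_support_iff.mp hm h
  rintro ⟨W, hW⟩
  have hW0 : W ≠ 0 := by rintro rfl; simp [hW] at hne
  have h1 := degreeOf_mul_eq (n := 1) hP0 hW0
  have h2 : degreeOf 1 (pderiv 1 P) ≤ P.degreeOf 1 - 1 := by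
    refine degreeOf_le_iff.mpr fun m hm => ?_
    rw [mem_support_iff, coeff_pderiv] at hm
    have := monomial_le_degreeOf 1 (mem_support_iff.mpr (left_ne_zero_of_mul hm))
    simp at this
    omega
  rw [hW] at h2
  omega

lemma eval_aeval_X_zero (x y : K) (R : Polynomial K) :
    eval ![x, y] (Polynomial.aeval (X 0 : MvPolynomial (Fin 2) K) R) = R.eval x := by
  rw [← MvPolynomial.coe_aeval_eq_eval, RingHom.coe_coe, ← Polynomial.aeval_algHom_apply]
  simp [Polynomial.aeval_def, Polynomial.eval₂_eq_eval_map]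

/-- A polynomial in `x` alone lying in the ideal `(P, Ψ)` inherits the vanishing order of `Ψ`
along the curve `P = 0`. -/
lemma X_sub_C_pow_dvd_of_iterate_curveDerivation {p : ℕ} [CharP K p]
    {P Ψ U V : MvPolynomial (Fin 2) K} {R : Polynomial K} (hR : R ≠ 0) {M : ℕ} (hM : M ≤ p)
    (hPrime : p.Prime)
    (hRUV : Polynomial.aeval (X 0 : MvPolynomial (Fin 2) K) R = U * P + V * Ψ) {x y : K}
    (hx : x ≠ 0) (hy : y ≠ 0) (hP : eval ![x, y] P = 0) (hPy : eval ![x, y] (pderiv 1 P) ≠ 0)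
    (hΨ : ∀ k < M, eval ![x, y] ((curveDerivation P)^[k] Ψ) = 0) :
    (Polynomial.X - Polynomial.C x) ^ M ∣ R := by
  obtain ⟨r, hr, hrx⟩ := Polynomial.exists_eq_pow_rootMultiplicity_mul_and_not_dvd R hR x
  set m := R.rootMultiplicity x
  by_contra hdvd
  have hmM : m < M := by
    by_contra! h
    exact hdvd (hr ▸ Dvd.dvd.mul_right (pow_dvd_pow _ h) _)
  have hPk : ∀ k < M, eval ![x, y] ((curveDerivation P)^[k] P) = 0 := by
    intro k _
    cases k with
    | zero => simpa using hP
    | succ k => rw [Function.iterate_succ_apply, curveDerivation_self, iterate_map_zero, map_zero]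
  have hzero : eval ![x, y] ((curveDerivation P)^[m]
      (Polynomial.aeval (X 0 : MvPolynomial (Fin 2) K) R)) = 0 := by
    rw [hRUV, iterate_map_add, map_add,
      map_iterate_derivation_mul_eq_zero _ _ M _ _ hPk m hmM,
      map_iterate_derivation_mul_eq_zero _ _ M _ _ hΨ m hmM, add_zero]
  rw [hr, map_mul, map_pow, map_sub, Polynomial.aeval_X, Polynomial.aeval_C, algebraMap_eq,
    map_iterate_derivation_pow_mul _ _ (by simp), eval_aeval_X_zero] at hzero
  have hfac : (m.factorial : K) ≠ 0 := by
    rw [Ne, CharP.cast_eq_zero_iff K p, hPrime.dvd_factorial]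
    omega
  have hδ : eval ![x, y] (curveDerivation P (X 0 - C x)) ≠ 0 := by
    rw [curveDerivation_apply]
    simp [hx, hy, hPy]
  have hrx' : r.eval x ≠ 0 := fun h => hrx (Polynomial.dvd_iff_isRoot.mpr h)
  exact mul_ne_zero (mul_ne_zero hfac (pow_ne_zero _ hδ)) hrx' hzero

end CurveDerivation

section Independence

open MvPolynomial

variable {K : Type*} [Field K]

lemma X_sub_C_dvd_sub_aeval (x₀ : K) (F : MvPolynomial (Fin 2) K) :
    (X 0 - C x₀ : MvPolynomial (Fin 2) K) ∣ F - Polynomial.aeval (X 1 : MvPolynomial (Fin 2) K)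
      (aeval ![Polynomial.C x₀, (Polynomial.X : Polynomial K)] F) := by
  rw [← Ideal.mem_span_singleton, ← Ideal.Quotient.eq]
  let π := Ideal.Quotient.mkₐ K (Ideal.span {(X 0 - C x₀ : MvPolynomial (Fin 2) K)})
  have : π = π.comp ((Polynomial.aeval (X 1 : MvPolynomial (Fin 2) K)).comp
      (aeval ![Polynomial.C x₀, (Polynomial.X : Polynomial K)])) := by
    refine MvPolynomial.algHom_ext fun i => ?_
    fin_cases i
    · simp only [AlgHom.comp_apply, aeval_X]
      have h : π (X 0) = π (C x₀) := Ideal.Quotient.eq.mpr (Ideal.mem_span_singleton_self _)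
      exact h.trans (congrArg π (Polynomial.aeval_C _ _).symm)
    · simp
  exact DFunLike.congr_fun this F

lemma not_dvd_X_zero_sub_C {P : MvPolynomial (Fin 2) K} (hPy : 1 ≤ P.degreeOf 1) (x₀ : K) :
    ¬ P ∣ X 0 - C x₀ := by
  rintro ⟨W, hW⟩
  have hne : (X 0 - C x₀ : MvPolynomial (Fin 2) K) ≠ 0 := by
    intro h
    have := congrArg (eval ![x₀ + 1, 0]) h
    simp at this
  have h := degreeOf_mul_eq (n := 1) (left_ne_zero_of_mul (hW ▸ hne))
    (right_ne_zero_of_mul (hW ▸ hne))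
  have h2 := degreeOf_sub_le 1 (X 0 : MvPolynomial (Fin 2) K) (C x₀)
  rw [degreeOf_X_of_ne (by simp), degreeOf_C] at h2
  rw [hW] at h2
  simp at h2
  omega

lemma irreducible_X_zero_sub_C (x₀ : K) : Irreducible (X 0 - C x₀ : MvPolynomial (Fin 2) K) := by
  let e : MvPolynomial (Fin 2) K ≃ₐ[K] MvPolynomial (Fin 2) K :=
    AlgEquiv.ofAlgHom (aeval ![X 0 - C x₀, X 1]) (aeval ![X 0 + C x₀, X 1])
      (by refine MvPolynomial.algHom_ext fun i => ?_; fin_cases i <;> simp [algebraMap_eq])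
      (by refine MvPolynomial.algHom_ext fun i => ?_; fin_cases i <;> simp [algebraMap_eq])
  have hX : e (X 0) = X 0 - C x₀ := by simp [e]
  rw [← hX]
  exact (MulEquiv.irreducible_iff e).mpr (X_prime (R := K) (i := (0 : Fin 2))).irreducible

lemma aeval_C_X_ne_zero {P : MvPolynomial (Fin 2) K} (hP : Irreducible P)
    (hPy : 1 ≤ P.degreeOf 1) (x₀ : K) :
    aeval ![Polynomial.C x₀, (Polynomial.X : Polynomial K)] P ≠ 0 := by
  intro h
  have hdvd := X_sub_C_dvd_sub_aeval x₀ P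
  rw [h, map_zero, sub_zero] at hdvd
  exact not_dvd_X_zero_sub_C hPy x₀
    ((irreducible_X_zero_sub_C x₀).associated_of_dvd hP hdvd).symm.dvd

lemma eval_aeval_X_one (x y : K) (R : Polynomial K) :
    eval ![x, y] (Polynomial.aeval (X 1 : MvPolynomial (Fin 2) K) R) = R.eval y := by
  rw [← MvPolynomial.coe_aeval_eq_eval, RingHom.coe_coe, ← Polynomial.aeval_algHom_apply]
  simp [Polynomial.aeval_def, Polynomial.eval₂_eq_eval_map]

lemma eval_aeval_C_X (x y : K) (F : MvPolynomial (Fin 2) K) :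
    (aeval ![Polynomial.C x, (Polynomial.X : Polynomial K)] F).eval y = eval ![x, y] F := by
  rw [← Polynomial.coe_aeval_eq_eval, ← AlgHom.comp_apply,
    ← MvPolynomial.coe_aeval_eq_eval, RingHom.coe_coe]
  congr 1
  refine MvPolynomial.algHom_ext fun i => ?_
  fin_cases i <;> simp

/-- On a curve through `(x₀, 0)`, a function of `x` vanishing to low order at `x₀` is not
divisible by a high power of `y`. -/
lemma not_dvd_aeval_add_X_pow_mul {P : MvPolynomial (Fin 2) K} (hP : Irreducible P)
    (hPy : 1 ≤ P.degreeOf 1) {x₀ : K} (hx₀ : eval ![x₀, 0] P = 0) {Q : Polynomial K} (hQ : Q ≠ 0)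
    {t : ℕ} (ht : P.degreeOf 1 * (Q.rootMultiplicity x₀ + 1) ≤ t) (H : MvPolynomial (Fin 2) K) :
    ¬ P ∣ Polynomial.aeval (X 0 : MvPolynomial (Fin 2) K) Q + X 1 ^ t * H := by
  intro hdvd
  obtain ⟨q, hq, hqx⟩ := Polynomial.exists_eq_pow_rootMultiplicity_mul_and_not_dvd Q hQ x₀
  set m := Q.rootMultiplicity x₀
  have hqx' : q.eval x₀ ≠ 0 := fun h => hqx (Polynomial.dvd_iff_isRoot.mpr h)
  set p₀ := aeval ![Polynomial.C x₀, (Polynomial.X : Polynomial K)] P with hp₀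
  have hp₀ne : p₀ ≠ 0 := aeval_C_X_ne_zero hP hPy x₀
  obtain ⟨v, hv, hv0⟩ := Polynomial.exists_eq_pow_rootMultiplicity_mul_and_not_dvd p₀ hp₀ne 0
  set f := p₀.rootMultiplicity 0
  have hv0' : v.eval 0 ≠ 0 := fun h => hv0 (Polynomial.dvd_iff_isRoot.mpr h)
  have hf : f ≤ P.degreeOf 1 := by
    have h1 := natDegree_aeval_C_X_le x₀ P
    have h2 := Polynomial.natDegree_le_of_dvd (Dvd.intro _ hv.symm) hp₀ne
    rw [Polynomial.natDegree_pow, Polynomial.natDegree_X_sub_C, mul_one] at h2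
    exact h2.trans h1
  obtain ⟨w, hw⟩ := X_sub_C_dvd_sub_aeval x₀ P
  set v' := Polynomial.aeval (X 1 : MvPolynomial (Fin 2) K) v
  set q' := Polynomial.aeval (X 0 : MvPolynomial (Fin 2) K) q
  set u : MvPolynomial (Fin 2) K := X 0 - C x₀ with hu
  have hvu : X 1 ^ f * v' = P - u * w := by
    have : Polynomial.aeval (X 1 : MvPolynomial (Fin 2) K) p₀ = X 1 ^ f * v' := by
      rw [hv]; simp [v']
    rw [← hw, ← hp₀, this]
    ring
  have hQ' : Polynomial.aeval (X 0 : MvPolynomial (Fin 2) K) Q = u ^ m * q' := by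
    rw [hq]; simp [q', hu, algebraMap_eq]
  obtain ⟨e, he⟩ : ∃ e, t = f * (m + 1) + e :=
    Nat.exists_eq_add_of_le ((Nat.mul_le_mul_right _ hf).trans ht)
  have hpow : P ∣ (X 1 ^ f * v') ^ (m + 1) - (-(u * w)) ^ (m + 1) :=
    dvd_trans ⟨1, by rw [hvu]; ring⟩ (sub_dvd_pow_sub_pow _ _ _)
  have hdvd' : P ∣ u ^ m *
      (q' * v' ^ (m + 1) + u * ((-1) ^ (m + 1) * w ^ (m + 1) * X 1 ^ e * H)) := by
    have := dvd_sub (hdvd.mul_left (v' ^ (m + 1))) (hpow.mul_left (X 1 ^ e * H))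
    convert this using 1
    have hX : (X 1 : MvPolynomial (Fin 2) K) ^ t = (X 1 ^ f) ^ (m + 1) * X 1 ^ e := by
      rw [he, pow_add, pow_mul]
    rw [hQ', hX, mul_pow (X 1 ^ f), neg_pow (u * w), mul_pow u w]
    ring
  rcases hP.prime.dvd_or_dvd hdvd' with h | h
  · exact not_dvd_X_zero_sub_C hPy x₀ (hP.prime.dvd_of_dvd_pow h)
  · obtain ⟨W, hW⟩ := h
    have := congrArg (eval ![x₀, 0]) hW
    rw [map_mul, hx₀, zero_mul, map_add, map_mul, map_pow, eval_aeval_X_zero,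
      eval_aeval_X_one, map_mul, hu] at this
    simp [hqx', hv0'] at this

/-- The functions `x^(a + b t) y^(c t)` are linearly independent on the curve `P = 0`. -/
lemma not_dvd_sum_smul_monomial {p : ℕ} [CharP K p] {P : MvPolynomial (Fin 2) K}
    (hP : Irreducible P) (hPy : 1 ≤ P.degreeOf 1) (hP00 : eval ![0, 0] P ≠ 0) {x₀ : K}
    (hx₀ : eval ![x₀, 0] P = 0) {A B C t : ℕ} (hAt : A ≤ t) (hABt : P.degreeOf 1 * (A * B) ≤ t)
    (hBt : B * t ≤ p) {c : Fin A × Fin B × Fin C → K} (hc : c ≠ 0) :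
    ¬ P ∣ ∑ i, c i • (X 0 ^ ((i.1 : ℕ) + i.2.1 * t) * X 1 ^ ((i.2.2 : ℕ) * t) :
      MvPolynomial (Fin 2) K) := by
  classical
  let Q : Fin C → Polynomial K := fun k =>
    ∑ ab : Fin A × Fin B, Polynomial.monomial ((ab.1 : ℕ) + ab.2 * t) (c (ab.1, ab.2, k))
  have hinj (ab ab' : Fin A × Fin B) (h : (ab.1 : ℕ) + ab.2 * t = ab'.1 + ab'.2 * t) :
      ab = ab' := by
    have h1 := ab.1.2
    have h2 := ab'.1.2
    have ht : 0 < t := by omega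
    have hm := congrArg (· % t) h
    have hd := congrArg (· / t) h
    simp only [Nat.add_mul_mod_self_right, Nat.mod_eq_of_lt (h1.trans_le hAt),
      Nat.mod_eq_of_lt (h2.trans_le hAt)] at hm
    simp only [Nat.add_mul_div_right _ _ ht, Nat.div_eq_of_lt (h1.trans_le hAt),
      Nat.div_eq_of_lt (h2.trans_le hAt), zero_add] at hd
    exact Prod.ext (Fin.ext hm) (Fin.ext hd)
  have hcoeff (k : Fin C) (ab : Fin A × Fin B) :
      (Q k).coeff ((ab.1 : ℕ) + ab.2 * t) = c (ab.1, ab.2, k) := by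
    simp only [Q, Polynomial.finsetSum_coeff, Polynomial.coeff_monomial]
    rw [Finset.sum_eq_single ab]
    · simp
    · intro ab' _ hne
      exact if_neg fun h => hne (hinj _ _ h)
    · simp
  have hsupp (k : Fin C) : (Q k).support ⊆
      Finset.univ.image fun ab : Fin A × Fin B => (ab.1 : ℕ) + ab.2 * t := by
    intro e he
    by_contra hne
    refine Polynomial.mem_support_iff.mp he ?_
    simp only [Q, Polynomial.finsetSum_coeff, Polynomial.coeff_monomial]
    refine Finset.sum_eq_zero fun ab _ => if_neg fun h => hne ?_
    exact Finset.mem_image.mpr ⟨ab, Finset.mem_univ _, h⟩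
  have hmult (k : Fin C) (hk : Q k ≠ 0) : (Q k).rootMultiplicity x₀ + 1 ≤ A * B := by
    have hcard : (Q k).support.card ≤ A * B := by
      refine (Finset.card_le_card (hsupp k)).trans (Finset.card_image_le.trans ?_)
      simp
    have hdeg : (Q k).natDegree < p := by
      obtain ⟨ab, -, hab⟩ := Finset.mem_image.mp
        (hsupp k (Polynomial.natDegree_mem_support_of_nonzero hk))
      rw [← hab]
      have h1 := ab.1.2
      have h2 : ((ab.2 : ℕ) + 1) * t ≤ B * t := Nat.mul_le_mul_right _ ab.2.2
      linarith
    have hx₀ne : x₀ ≠ 0 := by rintro rfl; exact hP00 hx₀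
    have hnot := not_X_sub_C_pow_card_support_dvd hx₀ne hk hdeg
    by_contra! hlt
    exact hnot ((pow_dvd_pow _ (by omega)).trans (Polynomial.pow_rootMultiplicity_dvd _ x₀))
  have hsum : ∑ i, c i • (X 0 ^ ((i.1 : ℕ) + i.2.1 * t) * X 1 ^ ((i.2.2 : ℕ) * t) :
      MvPolynomial (Fin 2) K) =
      ∑ k, Polynomial.aeval (X 0 : MvPolynomial (Fin 2) K) (Q k) * X 1 ^ ((k : ℕ) * t) := by
    simp only [Q, map_sum, Polynomial.aeval_monomial, Finset.sum_mul, Fintype.sum_prod_type,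
      smul_eq_C_mul, algebraMap_eq]
    rw [Finset.sum_comm_cycle]
    refine Finset.sum_congr rfl fun k _ => Finset.sum_congr rfl fun a _ =>
      Finset.sum_congr rfl fun b _ => by ring
  have hexists : ∃ k : Fin C, Q k ≠ 0 := by
    obtain ⟨i, hi⟩ := Function.ne_iff.mp hc
    refine ⟨i.2.2, fun h => hi ?_⟩
    rw [← hcoeff i.2.2 (i.1, i.2.1), h]
    simp
  obtain ⟨k₀, hk₀, hmin⟩ : ∃ k₀, Q k₀ ≠ 0 ∧ ∀ k < k₀, Q k = 0 := by
    obtain ⟨k₀, hk₀⟩ := WellFounded.has_min (wellFounded_lt (α := Fin C)) {k | Q k ≠ 0} hexists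
    exact ⟨k₀, hk₀.1, fun k hk => by_contra fun h => hk₀.2 k h hk⟩
  have hfactor : ∑ k, Polynomial.aeval (X 0 : MvPolynomial (Fin 2) K) (Q k) * X 1 ^ ((k : ℕ) * t) =
      X 1 ^ ((k₀ : ℕ) * t) * (Polynomial.aeval (X 0 : MvPolynomial (Fin 2) K) (Q k₀) +
        X 1 ^ t * ∑ k ∈ Finset.Ioi k₀, Polynomial.aeval (X 0 : MvPolynomial (Fin 2) K) (Q k) *
          X 1 ^ (((k : ℕ) - k₀ - 1) * t)) := by
    rw [mul_add, ← mul_assoc, Finset.mul_sum]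
    have hsub : ∑ k, Polynomial.aeval (X 0 : MvPolynomial (Fin 2) K) (Q k) *
        X 1 ^ ((k : ℕ) * t) = ∑ k ∈ Finset.Ici k₀,
          Polynomial.aeval (X 0 : MvPolynomial (Fin 2) K) (Q k) * X 1 ^ ((k : ℕ) * t) := by
      refine (Finset.sum_subset (Finset.subset_univ _) fun k _ hk => ?_).symm
      rw [hmin k (by simpa using hk), map_zero, zero_mul]
    rw [hsub, ← Finset.Ioi_insert, Finset.sum_insert (by simp), mul_comm]
    congr 1
    refine Finset.sum_congr rfl fun k hk => ?_
    have hlt : (k₀ : ℕ) < k := by simpa using hk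
    obtain ⟨e, he⟩ : ∃ e, (k : ℕ) = k₀ + 1 + e := Nat.exists_eq_add_of_le hlt
    rw [he, show (k₀ : ℕ) + 1 + e - k₀ - 1 = e by omega]
    ring
  intro hdvd
  rw [hsum, hfactor] at hdvd
  rcases hP.prime.dvd_or_dvd hdvd with h | h
  · have hX := hP.prime.dvd_of_dvd_pow h
    obtain ⟨W, hW⟩ := (hP.associated_of_dvd (X_prime (R := K) (i := (1 : Fin 2))).irreducible
      hX).symm.dvd
    rw [hW] at hP00
    simp at hP00
  · refine not_dvd_aeval_add_X_pow_mul hP hPy hx₀ hk₀ ?_ _ h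
    exact (Nat.mul_le_mul_left _ (hmult k₀ hk₀)).trans hABt

end Independence

/-- Parameters of the auxiliary polynomial: with `B ≈ τ / d₁` and `M ≈ B ^ 2 / (2 d₂)`, where `τ` is
the cube root of `t`, all constraints of Stepanov's method are satisfied. -/
lemma exists_auxiliary_parameters {d₁ d₂ t p : ℕ} (hd₁ : 1 ≤ d₁) (hd₂ : 1 ≤ d₂) {τ : ℝ}
    (hτ0 : 0 ≤ τ) (hτ : τ ^ 3 = t) (hτp : τ ^ 4 < p)
    (hlarge : 12 * d₁ * ((d₁ : ℝ) + d₂) ^ 2 < τ) :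
    ∃ B M : ℕ, 0 < t ∧ 0 < B ∧ 0 < M ∧ M ≤ p ∧ 2 * M * d₁ ≤ t ∧ d₂ * (2 * M * d₁ * B) ≤ t ∧
      B * t ≤ p ∧ d₂ < p ∧
      M * ((2 * M * d₁ + M * d₁) * (M * d₂ + 1)) < 2 * M * d₁ * (B * B) +
        M * ((2 * M * d₁ + M * d₁ - d₁) * (M * d₂ + 1 - d₂)) ∧
      9 / 10 * (B : ℝ) ^ 2 ≤ 2 * d₂ * M ∧ 9 / 10 * τ ≤ d₁ * B ∧ 1 ≤ τ := by
  obtain ⟨D, hD⟩ : ∃ D, D = d₁ + d₂ := ⟨_, rfl⟩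
  have hD2 : 2 ≤ D := by omega
  obtain ⟨u, huτ, hτu, hu_ge⟩ : ∃ u : ℕ, (u : ℝ) ≤ τ ∧ τ < u + 1 ∧ 12 * d₁ * D ^ 2 ≤ u :=
    ⟨⌊τ⌋₊, Nat.floor_le hτ0, Nat.lt_floor_add_one τ,
      Nat.le_floor (by push_cast [hD]; exact hlarge.le)⟩
  obtain ⟨B, hBge, hBu, huB⟩ : ∃ B, 12 * D ^ 2 ≤ B ∧ B * d₁ ≤ u ∧ u < d₁ * (B + 1) :=
    ⟨u / d₁, (Nat.le_div_iff_mul_le hd₁).mpr (by linarith), Nat.div_mul_le_self u d₁,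
      Nat.lt_mul_div_succ u hd₁⟩
  have hB48 : 48 ≤ B := by nlinarith
  have hBD : 24 * d₂ ≤ B := by nlinarith
  have hB2 : 48 * B ≤ B ^ 2 := by nlinarith
  obtain ⟨M, hMle, hMge⟩ : ∃ M, M * (2 * d₂) + 1 ≤ B ^ 2 ∧ B ^ 2 ≤ 2 * d₂ * (M + 1) := by
    have h1 := Nat.div_mul_le_self (B ^ 2 - 1) (2 * d₂)
    have h2 := Nat.lt_mul_div_succ (B ^ 2 - 1) (show 0 < 2 * d₂ by omega)
    exact ⟨(B ^ 2 - 1) / (2 * d₂), by omega, by omega⟩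
  have hMpos : 0 < M := by
    rcases Nat.eq_zero_or_pos M with rfl | h
    · omega
    · exact h
  have hBu' : B ≤ u := (Nat.le_mul_of_pos_right _ hd₁).trans hBu
  have hupos : 0 < u := by omega
  have hut : u ^ 3 ≤ t := by
    have : (u : ℝ) ^ 3 ≤ t := hτ ▸ pow_le_pow_left₀ (by positivity) huτ 3
    exact_mod_cast this
  have hutp : u * t ≤ p := by
    have : (u : ℝ) * t ≤ p := by
      rw [← hτ]
      calc (u : ℝ) * τ ^ 3 ≤ τ * τ ^ 3 := by gcongr
        _ = τ ^ 4 := by ring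
        _ ≤ p := hτp.le
    exact_mod_cast this
  have htpos : 0 < t := lt_of_lt_of_le (by positivity) hut
  have htp : t ≤ p := (Nat.le_mul_of_pos_left _ hupos).trans hutp
  have hABt : d₂ * (2 * M * d₁ * B) ≤ t := by
    have h1 : B * d₁ * (M * (2 * d₂)) ≤ u * u ^ 2 :=
      Nat.mul_le_mul hBu ((Nat.le_of_succ_le hMle).trans (Nat.pow_le_pow_left hBu' 2))
    calc d₂ * (2 * M * d₁ * B) = B * d₁ * (M * (2 * d₂)) := by ring
      _ ≤ u * u ^ 2 := h1
      _ = u ^ 3 := by ring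
      _ ≤ t := hut
  have hAt : 2 * M * d₁ ≤ t := by
    refine le_trans ?_ hABt
    calc 2 * M * d₁ ≤ 2 * M * d₁ * (d₂ * B) := Nat.le_mul_of_pos_right _ (by positivity)
      _ = d₂ * (2 * M * d₁ * B) := by ring
  have hMt : M ≤ t := by
    refine le_trans ?_ hAt
    nlinarith
  have hd₂p : d₂ < p := by
    have h1 : u ≤ u ^ 3 := Nat.le_self_pow (by norm_num) u
    omega
  have hd₁R : (1 : ℝ) ≤ d₁ := by exact_mod_cast hd₁
  have hd₂R : (1 : ℝ) ≤ d₂ := by exact_mod_cast hd₂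
  have hBR : (48 : ℝ) ≤ B := by exact_mod_cast hB48
  have hBDR : (24 : ℝ) * d₂ ≤ B := by exact_mod_cast hBD
  have hMgeR : (B : ℝ) ^ 2 ≤ 2 * d₂ * (M + 1) := by exact_mod_cast hMge
  have huBR : (u : ℝ) + 1 ≤ d₁ * (B + 1) := by exact_mod_cast huB
  refine ⟨B, M, htpos, by omega, hMpos, hMt.trans htp, hAt, hABt,
    (Nat.mul_le_mul_right t hBu').trans hutp, hd₂p, ?_, by nlinarith, by nlinarith,
    le_trans (by exact_mod_cast hupos) huτ⟩
  have h1 : d₁ ≤ 2 * M * d₁ + M * d₁ := by nlinarith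
  have h2 : d₂ ≤ M * d₂ + 1 := by nlinarith
  zify [h1, h2]
  zify at hMle hd₁ hd₂ hMpos
  have h3 : (0 : ℤ) < M * d₁ := by positivity
  have h4 := mul_le_mul_of_nonneg_left hMle h3.le
  have h5 := mul_nonneg h3.le (sub_nonneg.mpr hd₂)
  nlinarith

/-- The numerical conclusion of Stepanov's method for the parameters above. -/
lemma add_le_of_auxiliary_parameters {d₁ d₂ τ g B M : ℝ} (hd₁ : 1 ≤ d₁) (hd₂ : 1 ≤ d₂)
    (hτ : 1 ≤ τ) (hg0 : 0 ≤ g) (hB : 0 < B) (hBM : 9 / 10 * B ^ 2 ≤ 2 * d₂ * M)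
    (hτB : 9 / 10 * τ ≤ d₁ * B) (hg : g * M ≤ B * τ ^ 3 * d₁ + d₂ * (B * τ ^ 3)) :
    g + 2 * d₁ * d₂ ≤ 12 * d₁ * (d₁ + d₂) ^ 2 * τ ^ 2 := by
  have hgB : 9 / 10 * g * B ≤ 2 * d₂ * (d₁ + d₂) * τ ^ 3 := by
    refine le_of_mul_le_mul_right ?_ hB
    calc 9 / 10 * g * B * B = g * (9 / 10 * B ^ 2) := by ring
      _ ≤ g * (2 * d₂ * M) := by gcongr
      _ = 2 * d₂ * (g * M) := by ring
      _ ≤ 2 * d₂ * (B * τ ^ 3 * d₁ + d₂ * (B * τ ^ 3)) := by gcongr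
      _ = 2 * d₂ * (d₁ + d₂) * τ ^ 3 * B := by ring
  have hgτ : 81 / 100 * g ≤ 2 * d₁ * d₂ * (d₁ + d₂) * τ ^ 2 := by
    refine le_of_mul_le_mul_right ?_ (show 0 < τ by linarith)
    calc 81 / 100 * g * τ = 9 / 10 * g * (9 / 10 * τ) := by ring
      _ ≤ 9 / 10 * g * (d₁ * B) := by gcongr
      _ = d₁ * (9 / 10 * g * B) := by ring
      _ ≤ d₁ * (2 * d₂ * (d₁ + d₂) * τ ^ 3) := by gcongr
      _ = 2 * d₁ * d₂ * (d₁ + d₂) * τ ^ 2 * τ := by ring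
  have hτ1 : 1 ≤ τ ^ 2 := one_le_pow₀ hτ
  have hdD : d₂ * (d₁ + d₂) ≤ (d₁ + d₂) ^ 2 := by nlinarith
  have hdD' : d₂ ≤ (d₁ + d₂) ^ 2 := by nlinarith
  have h1 : 2 * d₁ * d₂ * (d₁ + d₂) * τ ^ 2 ≤ 2 * (d₁ * (d₁ + d₂) ^ 2 * τ ^ 2) := by
    calc 2 * d₁ * d₂ * (d₁ + d₂) * τ ^ 2 = 2 * (d₁ * (d₂ * (d₁ + d₂)) * τ ^ 2) := by ring
      _ ≤ _ := by gcongr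
  have h2 : 2 * d₁ * d₂ ≤ 2 * (d₁ * (d₁ + d₂) ^ 2 * τ ^ 2) := by
    calc 2 * d₁ * d₂ = 2 * (d₁ * d₂ * 1) := by ring
      _ ≤ _ := by gcongr
  have h3 : 0 ≤ d₁ * (d₁ + d₂) ^ 2 * τ ^ 2 := by positivity
  linarith

section Counting

open MvPolynomial

variable {K : Type*} [Field K]

/-- Abscissae of points of the curve `P = 0` where the tangent is vertical. -/
lemma card_le_of_pderiv_eq_zero {p : ℕ} [CharP K p] {P : MvPolynomial (Fin 2) K}
    (hP : Irreducible P) (hPy : 1 ≤ P.degreeOf 1) (hp : P.degreeOf 1 < p) (S : Finset K)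
    (hS : ∀ x ∈ S, ∃ y, eval ![x, y] P = 0 ∧ eval ![x, y] (pderiv 1 P) = 0) :
    S.card ≤ 2 * P.degreeOf 0 * P.degreeOf 1 := by
  obtain ⟨R, hR, hdeg, U, V, hUV⟩ := exists_elimination hP (not_dvd_pderiv_one (p := p) hPy hp) hPy
    (degreeOf_pderiv_le 1 0 P) (degreeOf_pderiv_le 1 1 P)
  have := card_mul_le_natDegree hR S 1 fun x hx => by
    obtain ⟨y, hy, hy'⟩ := hS x hx
    rw [pow_one, Polynomial.dvd_iff_isRoot, Polynomial.IsRoot, ← eval_aeval_X_zero x y, hUV,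
      map_add, map_mul, map_mul, hy, hy', mul_zero, mul_zero, add_zero]
  linarith

/-- Stepanov's method: abscissae of points of the curve `P = 0` with `x ^ t = y ^ t = 1` and
non-vertical tangent, in terms of the parameters of the auxiliary polynomial. -/
lemma card_mul_le_of_auxiliary_parameters {p : ℕ} [CharP K p] (hPrime : p.Prime)
    {P : MvPolynomial (Fin 2) K} (hP : Irreducible P) (hPy : 1 ≤ P.degreeOf 1)
    (hP00 : eval ![0, 0] P ≠ 0) {x₀ : K} (hx₀ : eval ![x₀, 0] P = 0) {A B C M t : ℕ} (ht : 0 < t)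
    (hM : 0 < M) (hMp : M ≤ p) (hAt : A ≤ t) (hABt : P.degreeOf 1 * (A * B) ≤ t)
    (hBt : B * t ≤ p)
    (hcard : M * ((A + M * P.degreeOf 0) * (M * P.degreeOf 1 + 1)) < A * (B * C) +
      M * ((A + M * P.degreeOf 0 - P.degreeOf 0) * (M * P.degreeOf 1 + 1 - P.degreeOf 1)))
    (S : Finset K)
    (hS : ∀ x ∈ S, ∃ y, x ^ t = 1 ∧ y ^ t = 1 ∧ eval ![x, y] P = 0 ∧
      eval ![x, y] (pderiv 1 P) ≠ 0) :
    S.card * M ≤ C * t * P.degreeOf 0 + P.degreeOf 1 * (B * t) := by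
  have hle (d : ℕ) : d ≤ M * d := Nat.le_mul_of_pos_left _ hM
  obtain ⟨c, hc, hdvd⟩ := exists_linearCombination_dvd (ι := Fin A × Fin B × Fin C) (M := M)
    hP.ne_zero (a := A + M * P.degreeOf 0) (b := M * P.degreeOf 1 + 1)
    ((hle _).trans (Nat.le_add_left _ _)) ((hle _).trans (Nat.le_succ _))
    (fun i k => X 0 ^ (i.1 : ℕ) * monomialCofactor P (i.1 + i.2.1 * t) (i.2.2 * t) k)
    (fun i k => by
      have h (l : Fin 2) := (degreeOf_monomialCofactor_le P (i.1 + i.2.1 * t) (i.2.2 * t) k l).trans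
        (Nat.mul_le_mul_right _ k.2.le)
      refine mem_bidegreeLT_of_degreeOf ?_ ?_
      · refine (degreeOf_mul_le _ _ _).trans_lt ?_
        rw [degreeOf_X_self_pow]
        have := h 0
        have := i.1.2
        omega
      · refine (degreeOf_mul_le _ _ _).trans_lt ?_
        rw [degreeOf_X_pow_of_ne _ (by simp)]
        have := h 1
        omega)
    (by simpa using hcard)
  set Ψ : MvPolynomial (Fin 2) K :=
    ∑ i, c i • (X 0 ^ ((i.1 : ℕ) + i.2.1 * t) * X 1 ^ ((i.2.2 : ℕ) * t)) with hΨ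
  have hnot : ¬ P ∣ Ψ :=
    not_dvd_sum_smul_monomial hP hPy hP00 hx₀ hAt hABt hBt hc
  have hΨ0 : Ψ.degreeOf 0 ≤ B * t := by
    refine (degreeOf_sum_le _ _ _).trans (Finset.sup_le fun i _ => ?_)
    rw [smul_eq_C_mul]
    refine (degreeOf_C_mul_le _ _ _).trans ((degreeOf_mul_le _ _ _).trans ?_)
    rw [degreeOf_X_self_pow, degreeOf_X_pow_of_ne _ (by simp)]
    have h1 := i.1.2
    have h2 : ((i.2.1 : ℕ) + 1) * t ≤ B * t := Nat.mul_le_mul_right _ i.2.1.2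
    linarith
  have hΨ1 : Ψ.degreeOf 1 ≤ C * t := by
    refine (degreeOf_sum_le _ _ _).trans (Finset.sup_le fun i _ => ?_)
    rw [smul_eq_C_mul]
    refine (degreeOf_C_mul_le _ _ _).trans ((degreeOf_mul_le _ _ _).trans ?_)
    rw [degreeOf_X_self_pow, degreeOf_X_pow_of_ne _ (by simp), zero_add]
    exact Nat.mul_le_mul_right _ i.2.2.2.le
  obtain ⟨R, hR, hdeg, U, V, hUV⟩ := exists_elimination hP hnot hPy hΨ0 hΨ1
  refine (card_mul_le_natDegree hR S M fun x hx => ?_).trans hdeg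
  obtain ⟨y, hxt, hyt, hxy, hy'⟩ := hS x hx
  have hne {z : K} (hz : z ^ t = 1) : z ≠ 0 := by
    rintro rfl
    simp [ht.ne'] at hz
  refine X_sub_C_pow_dvd_of_iterate_curveDerivation hR hMp hPrime hUV (hne hxt) (hne hyt) hxy hy'
    fun k hk => ?_
  obtain ⟨W, hW⟩ := hdvd ⟨k, hk⟩
  have hzero := congrArg (eval ![x, y]) hW
  rw [map_mul, hxy, zero_mul] at hzero
  have hiter (F : MvPolynomial (Fin 2) K) : (curveDerivation P)^[k] F =
      ((curveDerivation P : MvPolynomial (Fin 2) K →ₗ[K] MvPolynomial (Fin 2) K) ^ k) F :=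
    (Module.End.pow_apply _ _ _).symm
  rw [← hzero, hΨ, hiter, map_sum, map_sum, map_sum]
  refine Finset.sum_congr rfl fun i _ => ?_
  rw [map_smul, ← hiter, iterate_curveDerivation_monomial]
  simp [smul_eval, pow_add, pow_mul', hxt, hyt]

/-- The points of the curve `P = 0` over a finite set of abscissae. -/
lemma card_le_degreeOf_mul_card {P : MvPolynomial (Fin 2) K} (hP : Irreducible P)
    (hPy : 1 ≤ P.degreeOf 1) (N : Finset (K × K)) (S : Finset K)
    (hN : ∀ q ∈ N, q.1 ∈ S ∧ eval ![q.1, q.2] P = 0) :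
    N.card ≤ P.degreeOf 1 * S.card := by
  classical
  refine Finset.card_le_mul_card_image_of_maps_to (f := Prod.fst) (fun q hq => (hN q hq).1) _
    fun x _ => ?_
  set p₀ := aeval ![Polynomial.C x, (Polynomial.X : Polynomial K)] P
  have hp₀ : p₀ ≠ 0 := aeval_C_X_ne_zero hP hPy x
  calc (N.filter fun q => q.1 = x).card ≤ p₀.roots.toFinset.card := by
        refine Finset.card_le_card_of_injOn Prod.snd (fun q hq => ?_) fun q hq q' hq' h => ?_
        · rw [Finset.mem_coe, Finset.mem_filter] at hq
          rw [Finset.mem_coe, Multiset.mem_toFinset, Polynomial.mem_roots hp₀, Polynomial.IsRoot,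
            eval_aeval_C_X, ← hq.2]
          exact (hN q hq.1).2
        · simp only [Finset.coe_filter, Set.mem_ofPred_eq] at hq hq'
          exact Prod.ext (hq.2.trans hq'.2.symm) h
    _ ≤ p₀.natDegree := (Multiset.toFinset_card_le _).trans (Polynomial.card_roots' _)
    _ ≤ P.degreeOf 1 := natDegree_aeval_C_X_le x P

/-- The bound for abscissae in the range where the trivial bound does not suffice; `τ` is the
cube root of `t`. -/
lemma card_abscissae_le {p : ℕ} [CharP K p] (hPrime : p.Prime)
    {P : MvPolynomial (Fin 2) K} (hP : Irreducible P) (hPx : 1 ≤ P.degreeOf 0)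
    (hPy : 1 ≤ P.degreeOf 1) (hP00 : eval ![0, 0] P ≠ 0) {x₀ : K} (hx₀ : eval ![x₀, 0] P = 0)
    {t : ℕ} {τ : ℝ} (hτ0 : 0 ≤ τ) (hτ : τ ^ 3 = t) (hτp : τ ^ 4 < p)
    (hlarge : 12 * P.degreeOf 0 * ((P.degreeOf 0 : ℝ) + P.degreeOf 1) ^ 2 < τ) (S : Finset K)
    (hS : ∀ x ∈ S, ∃ y, x ^ t = 1 ∧ y ^ t = 1 ∧ eval ![x, y] P = 0) :
    (S.card : ℝ) ≤ 12 * P.degreeOf 0 * ((P.degreeOf 0 : ℝ) + P.degreeOf 1) ^ 2 * τ ^ 2 := by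
  classical
  obtain ⟨B, M, ht, hB, hM, hMp, hAt, hABt, hBt, hd₂p, hcard, hBM, hτB, hτ1⟩ :=
    exists_auxiliary_parameters hPx hPy hτ0 hτ hτp hlarge
  let good (x : K) : Prop := ∃ y, x ^ t = 1 ∧ y ^ t = 1 ∧ eval ![x, y] P = 0 ∧
    eval ![x, y] (pderiv 1 P) ≠ 0
  have hgood := card_mul_le_of_auxiliary_parameters hPrime hP hPy hP00 hx₀ ht hM hMp hAt hABt hBt
    hcard (S.filter good) fun x hx => (Finset.mem_filter.mp hx).2
  have hbad := card_le_of_pderiv_eq_zero hP hPy hd₂p (S.filter fun x => ¬ good x) fun x hx => by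
    obtain ⟨hxS, hnot⟩ := Finset.mem_filter.mp hx
    obtain ⟨y, hxt, hyt, hxy⟩ := hS x hxS
    exact ⟨y, hxy, by_contra fun h => hnot ⟨y, hxt, hyt, hxy, h⟩⟩
  have hgoodR : ((S.filter good).card : ℝ) * M ≤
      B * τ ^ 3 * P.degreeOf 0 + P.degreeOf 1 * (B * τ ^ 3) := by
    rw [hτ]
    exact_mod_cast hgood
  have hcardS : (S.card : ℝ) ≤ (S.filter good).card + 2 * P.degreeOf 0 * P.degreeOf 1 := by
    have := S.card_filter_add_card_filter_not good
    exact_mod_cast this ▸ Nat.add_le_add_left hbad _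
  exact hcardS.trans (add_le_of_auxiliary_parameters (by exact_mod_cast hPx)
    (by exact_mod_cast hPy) hτ1 (Nat.cast_nonneg _) (by exact_mod_cast hB) hBM hτB hgoodR)

lemma exists_eval_zero_of_natDegree_aeval_pos [IsAlgClosed K] {P : MvPolynomial (Fin 2) K}
    (h : 1 ≤ (aeval ![(Polynomial.X : Polynomial K), 0] P).natDegree) :
    ∃ x₀, eval ![x₀, 0] P = 0 := by
  obtain ⟨x₀, hx₀⟩ := IsAlgClosed.exists_root (aeval ![(Polynomial.X : Polynomial K), 0] P)
    (Polynomial.natDegree_pos_iff_degree_pos.mp h).ne'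
  refine ⟨x₀, Eq.trans ?_ hx₀⟩
  rw [← Polynomial.coe_aeval_eq_eval, ← AlgHom.comp_apply,
    ← MvPolynomial.coe_aeval_eq_eval, RingHom.coe_coe]
  congr 1
  refine MvPolynomial.algHom_ext fun i => ?_
  fin_cases i <;> simp

/-- The number of points with `x ^ t = y ^ t = 1` on the curve `P = 0`; `τ` is the cube root of
`t`. -/
lemma card_points_le [IsAlgClosed K] {p : ℕ} [CharP K p] (hPrime : p.Prime)
    {P : MvPolynomial (Fin 2) K} (hP : Irreducible P) (hPy : 1 ≤ P.degreeOf 1)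
    (hP00 : eval ![0, 0] P ≠ 0)
    (hPx0 : 1 ≤ (aeval ![(Polynomial.X : Polynomial K), 0] P).natDegree)
    {t : ℕ} (ht : 0 < t) {τ : ℝ} (hτ0 : 0 ≤ τ) (hτ : τ ^ 3 = t) (hτp : τ ^ 4 < p)
    (N : Finset (K × K))
    (hN : ∀ q ∈ N, q.1 ^ t = 1 ∧ q.2 ^ t = 1 ∧ eval ![q.1, q.2] P = 0) :
    (N.card : ℝ) ≤ 12 * P.degreeOf 0 * P.degreeOf 1 *
      ((P.degreeOf 0 : ℝ) + P.degreeOf 1) ^ 2 * τ ^ 2 := by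
  classical
  obtain ⟨x₀, hx₀⟩ := exists_eval_zero_of_natDegree_aeval_pos hPx0
  have hPx : 1 ≤ P.degreeOf 0 := hPx0.trans (by simpa using natDegree_aeval_X_C_le 0 P)
  set S := N.image Prod.fst
  have hNS : (N.card : ℝ) ≤ P.degreeOf 1 * S.card := by
    exact_mod_cast card_le_degreeOf_mul_card hP hPy N S fun q hq =>
      ⟨Finset.mem_image_of_mem _ hq, (hN q hq).2.2⟩
  have hS (x : K) (hx : x ∈ S) : ∃ y, x ^ t = 1 ∧ y ^ t = 1 ∧ eval ![x, y] P = 0 := by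
    obtain ⟨q, hq, rfl⟩ := Finset.mem_image.mp hx
    exact ⟨q.2, hN q hq⟩
  have hScard : (S.card : ℝ) ≤
      12 * P.degreeOf 0 * ((P.degreeOf 0 : ℝ) + P.degreeOf 1) ^ 2 * τ ^ 2 := by
    rcases lt_or_ge (12 * P.degreeOf 0 * ((P.degreeOf 0 : ℝ) + P.degreeOf 1) ^ 2) τ with h | h
    · exact card_abscissae_le hPrime hP hPx hPy hP00 hx₀ hτ0 hτ hτp h S hS
    · have hroots : S.card ≤ t := by
        refine le_trans (Finset.card_le_card fun x hx => ?_) (Polynomial.card_nthRoots t (1 : K)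
          |> (Multiset.toFinset_card_le _).trans)
        rw [Multiset.mem_toFinset, Polynomial.mem_nthRoots ht]
        exact (hS x hx).choose_spec.1
      calc (S.card : ℝ) ≤ t := by exact_mod_cast hroots
        _ = τ * τ ^ 2 := by rw [← hτ]; ring
        _ ≤ _ := by gcongr
  calc (N.card : ℝ) ≤ P.degreeOf 1 * S.card := hNS
    _ ≤ P.degreeOf 1 *
        (12 * P.degreeOf 0 * ((P.degreeOf 0 : ℝ) + P.degreeOf 1) ^ 2 * τ ^ 2) := by gcongr
    _ = _ := by ring

end Counting

/-- Theorem 2 of Makarychev–Vyugin.  Let `p` be a prime, `s ≥ 1`, and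
`P ∈ 𝔽̄_p[x,y]` an absolutely irreducible polynomial of bidegree `(d₁, d₂)` with
`d₂ ≥ 1`, `P(0,0) ≠ 0` and `deg_x P(x,0) ≥ 1`.  Let `G ≤ 𝔽_{p^s}ˣ` be a subgroup
(realized as a subgroup of `𝔽̄_pˣ` whose elements satisfy `x^{p^s} = x`) with
`10³ < |G| < (1/3) p^{3/4}`.  Then the number of `(x,y) ∈ G × G` with
`P(x,y) = 0` is at most `12 d₁ d₂ (d₁+d₂)² |G|^{2/3}`. -/
theorem subgroup_curve_points_bound
    (p : ℕ) [hp : Fact p.Prime] (s : ℕ) (hs : 1 ≤ s)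
    (P : MvPolynomial (Fin 2) (Fpbar p)) (hPirr : Irreducible P)
    (d1 d2 : ℕ) (hd1 : P.degreeOf 0 = d1) (hd2 : P.degreeOf 1 = d2) (hd2pos : 1 ≤ d2)
    (hP00 : MvPolynomial.eval ![(0 : Fpbar p), 0] P ≠ 0)
    (hPx0 : 1 ≤ (MvPolynomial.aeval ![(Polynomial.X : Polynomial (Fpbar p)), 0] P).natDegree)
    (G : Subgroup (Fpbar p)ˣ)
    (hGsub : ∀ x ∈ G, (x : Fpbar p) ^ (p ^ s) = (x : Fpbar p))
    (hGlb : 10 ^ 3 < Nat.card G)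
    (hGub : (Nat.card G : ℝ) < (1 / 3) * (p : ℝ) ^ ((3 : ℝ) / 4)) :
    ({q : (Fpbar p)ˣ × (Fpbar p)ˣ | q.1 ∈ G ∧ q.2 ∈ G ∧
        MvPolynomial.eval ![(q.1 : Fpbar p), (q.2 : Fpbar p)] P = 0}.ncard : ℝ) ≤
      12 * d1 * d2 * ((d1 : ℝ) + d2) ^ 2 * (Nat.card G : ℝ) ^ ((2 : ℝ) / 3) := by
  subst hd1 hd2
  set t := Nat.card G
  have : Finite G := Nat.finite_of_card_ne_zero (by omega)
  have : CharP (Fpbar p) p := charP_of_injective_algebraMap (algebraMap (ZMod p) _).injective p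
  have hpow {x : (Fpbar p)ˣ} (hx : x ∈ G) : (x : Fpbar p) ^ t = 1 := by
    have : x ^ t = 1 := congrArg Subtype.val (pow_card_eq_one' : (⟨x, hx⟩ : G) ^ t = 1)
    rw [← Units.val_pow_eq_pow_val, this, Units.val_one]
  have hrpow (a : ℝ) (n : ℕ) : ((t : ℝ) ^ a) ^ n = (t : ℝ) ^ (a * n) := by
    rw [Real.rpow_mul (Nat.cast_nonneg _), Real.rpow_natCast]
  have hτp : ((t : ℝ) ^ (1 / 3 : ℝ)) ^ 4 < p := by
    have hp0 : (0 : ℝ) ≤ p := Nat.cast_nonneg _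
    have hlt : (t : ℝ) < (p : ℝ) ^ ((3 : ℝ) / 4) := by
      have := Real.rpow_nonneg hp0 (3 / 4)
      linarith
    have := Real.rpow_lt_rpow (Nat.cast_nonneg _) hlt (show (0 : ℝ) < 4 / 3 by norm_num)
    rw [← Real.rpow_mul hp0] at this
    rw [hrpow]
    norm_num at this ⊢
    exact this
  let f : (Fpbar p)ˣ × (Fpbar p)ˣ → Fpbar p × Fpbar p := Prod.map Units.val Units.val
  have hf : Function.Injective f := Units.val_injective.prodMap Units.val_injective
  set N := {q : (Fpbar p)ˣ × (Fpbar p)ˣ | q.1 ∈ G ∧ q.2 ∈ G ∧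
    MvPolynomial.eval ![(q.1 : Fpbar p), (q.2 : Fpbar p)] P = 0}
  have hNfin : (f '' N).Finite :=
    (((Set.toFinite (G : Set (Fpbar p)ˣ)).prod (Set.toFinite (G : Set (Fpbar p)ˣ))).subset
      fun q hq => ⟨hq.1, hq.2.1⟩).image f
  have h := card_points_le hp.out hPirr hd2pos hP00 hPx0 (t := t) (by omega)
    (Real.rpow_nonneg (Nat.cast_nonneg t) (1 / 3)) (by rw [hrpow]; norm_num) hτp hNfin.toFinset
    fun q hq => by
      obtain ⟨q, ⟨h1, h2, h3⟩, rfl⟩ := hNfin.mem_toFinset.mp hq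
      exact ⟨hpow h1, hpow h2, h3⟩
  rw [← Set.ncard_eq_toFinset_card _ hNfin, Set.ncard_image_of_injective _ hf, hrpow] at h
  norm_num at h ⊢
  exact h
end

section
/- Let F be an algebraically closed field and α, β, γ, δ, r ∈ F with α·β·γ·δ·r ≠ 0. Then the bivariate polynomial P_1(x,y) = α x^2 y + γ x y^2 − r x y + δ x + β y is irreducible in F[x,y]. -/
open MvPolynomial

/-- A quadratic over a domain whose leading and constant coefficients are unit multiples of a
prime `t` is irreducible, as soon as the middle coefficient `m` is not divisible by `t` and is
not of the form `u * t ^ 2 + v` with units `u`, `v`. -/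
theorem irreducible_quadratic_of_prime {R : Type*} [CommRing R] [IsDomain R] {t a b m : R}
    (ht : Prime t) (ha : IsUnit a) (hb : IsUnit b) (hm : ¬ t ∣ m)
    (hne : ∀ u v : R, IsUnit u → IsUnit v → m ≠ u * t ^ 2 + v) :
    Irreducible (Polynomial.C (a * t) * Polynomial.X ^ 2 + Polynomial.C m * Polynomial.X +
      Polynomial.C (b * t)) := by
  have hat : a * t ≠ 0 := mul_ne_zero ha.ne_zero ht.ne_zero
  set p := Polynomial.C (a * t) * Polynomial.X ^ 2 + Polynomial.C m * Polynomial.X +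
      Polynomial.C (b * t) with hp
  have hdeg : p.natDegree = 2 := Polynomial.natDegree_quadratic hat
  have hp0 : p ≠ 0 := fun h0 => by simp [h0] at hdeg
  have c0 : p.coeff 0 = b * t := by simp [hp]
  have c1 : p.coeff 1 = m := by simp [hp, Polynomial.coeff_C, -map_mul]
  have c2 : p.coeff 2 = a * t := by simp [hp, -map_mul]
  have const : ∀ f g : Polynomial R, p = f * g → f.natDegree = 0 → IsUnit f := by
    intro f g hfg hf
    obtain ⟨c, rfl⟩ := Polynomial.natDegree_eq_zero.mp hf
    have h1 : c ∣ m := ⟨g.coeff 1, by rw [← c1, hfg, Polynomial.coeff_C_mul]⟩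
    have h2 : c ∣ t := ha.dvd_mul_left.mp ⟨g.coeff 2, by rw [← c2, hfg, Polynomial.coeff_C_mul]⟩
    obtain ⟨d, hd⟩ := h2
    rcases ht.irreducible.isUnit_or_isUnit hd with hu | hu
    · exact hu.map Polynomial.C
    · exact absurd ((hu.dvd_mul_right.mp (hd ▸ dvd_refl t)).trans h1) hm
  have linear : ∀ a₁ a₀ b₁ b₀ : R, a₁ * b₁ = a * t → a₀ * b₀ = b * t → a₁ * b₀ + a₀ * b₁ = m →
      t ∣ a₁ → False := by
    rintro a₁ a₀ b₁ b₀ h2 h0 h1 ⟨u, rfl⟩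
    have hub : u * b₁ = a := mul_right_cancel₀ ht.ne_zero (by linear_combination h2)
    rcases ht.dvd_or_dvd (show t ∣ a₀ * b₀ from h0 ▸ dvd_mul_left t b) with ⟨v, rfl⟩ | ⟨v, rfl⟩
    · exact hm ⟨u * b₀ + v * b₁, by linear_combination -h1⟩
    · have hv : a₀ * v = b := mul_right_cancel₀ ht.ne_zero (by linear_combination h0)
      rw [← hub, IsUnit.mul_iff] at ha
      rw [← hv, IsUnit.mul_iff] at hb
      exact hne (u * v) (a₀ * b₁) (ha.1.mul hb.2) (hb.1.mul ha.2) (by linear_combination -h1)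
  refine ⟨fun hu => by simp [Polynomial.natDegree_eq_zero_of_isUnit hu] at hdeg, ?_⟩
  intro f g hfg
  have hf0 : f ≠ 0 := by rintro rfl; simp [hfg] at hp0
  have hg0 : g ≠ 0 := by rintro rfl; simp [hfg] at hp0
  have hsum : f.natDegree + g.natDegree = 2 := by
    rw [← Polynomial.natDegree_mul hf0 hg0, ← hfg, hdeg]
  by_cases hf : f.natDegree = 0
  · exact Or.inl (const f g hfg hf)
  by_cases hg : g.natDegree = 0
  · exact Or.inr (const g f (by rw [hfg, mul_comm]) hg)
  exfalso
  obtain ⟨a₁, a₀, rfl⟩ := Polynomial.exists_eq_X_add_C_of_natDegree_le_one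
    (show f.natDegree ≤ 1 by omega)
  obtain ⟨b₁, b₀, rfl⟩ := Polynomial.exists_eq_X_add_C_of_natDegree_le_one
    (show g.natDegree ≤ 1 by omega)
  have hexp : p = Polynomial.C (a₁ * b₁) * Polynomial.X ^ 2 +
      Polynomial.C (a₁ * b₀ + a₀ * b₁) * Polynomial.X + Polynomial.C (a₀ * b₀) := by
    rw [hfg]; simp only [map_mul, map_add]; ring
  have e0 : a₀ * b₀ = b * t := by rw [← c0, hexp]; simp
  have e1 : a₁ * b₀ + a₀ * b₁ = m := by
    rw [← c1, hexp]; simp [Polynomial.coeff_C, -map_add, -map_mul]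
  have e2 : a₁ * b₁ = a * t := by
    rw [← c2, hexp]; simp [-map_add, -map_mul]
  rcases ht.dvd_or_dvd (show t ∣ a₁ * b₁ from e2 ▸ dvd_mul_left t a) with h | h
  · exact linear a₁ a₀ b₁ b₀ e2 e0 e1 h
  · exact linear b₁ b₀ a₁ a₀ (by rw [mul_comm, e2]) (by rw [mul_comm, e0])
      (by linear_combination e1) h

/-- Lemma 4: over an algebraically closed field `F`, for `α, β, γ, δ, r ∈ F` with
`αβγδr ≠ 0`, the polynomial `P₁(x,y) = α x²y + γ xy² - r xy + δ x + β y` is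
irreducible in `F[x,y]`. -/
theorem P1_irreducible
    (F : Type*) [Field F] [IsAlgClosed F]
    (α β γ δ r : F) (h : α * β * γ * δ * r ≠ 0) :
    Irreducible
      (C α * X 0 ^ 2 * X 1 + C γ * X 0 * X 1 ^ 2 - C r * (X 0 * X 1) +
        C δ * X 0 + C β * X 1 : MvPolynomial (Fin 2) F) := by
  simp only [mul_ne_zero_iff] at h
  obtain ⟨⟨⟨⟨hα, hβ⟩, -⟩, hδ⟩, hr⟩ := h
  let e : MvPolynomial (Fin 2) F ≃ₐ[F] Polynomial (Polynomial F) :=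
    (finSuccEquiv F 1).trans (Polynomial.mapAlgEquiv (uniqueAlgEquiv F (Fin 1)))
  have eX0 : e (X 0) = Polynomial.X := by simp [e, finSuccEquiv_X_zero]
  have eX1 : e (X 1) = Polynomial.C Polynomial.X := by
    have : finSuccEquiv F 1 (X 1) = Polynomial.C (X 0) := finSuccEquiv_X_succ (j := 0)
    simp [e, this]
  have eC : ∀ c : F, e (C c) = Polynomial.C (Polynomial.C c) := fun c => e.commutes c
  have hunit : ∀ c : F, c ≠ 0 → IsUnit (Polynomial.C c) := fun c hc =>
    Polynomial.isUnit_C.mpr (isUnit_iff_ne_zero.mpr hc)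
  have key := irreducible_quadratic_of_prime (t := (Polynomial.X : Polynomial F))
    (a := Polynomial.C α) (b := Polynomial.C β)
    (m := Polynomial.C γ * Polynomial.X ^ 2 + Polynomial.C (-r) * Polynomial.X + Polynomial.C δ)
    Polynomial.prime_X (hunit α hα) (hunit β hβ)
    (by rw [Polynomial.X_dvd_iff]; simpa using hδ)
    (by
      intro u v hu hv heq
      obtain ⟨u, -, rfl⟩ := Polynomial.isUnit_iff.mp hu
      obtain ⟨v, -, rfl⟩ := Polynomial.isUnit_iff.mp hv
      have := congrArg (fun q => Polynomial.coeff q 1) heq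
      simp [Polynomial.coeff_C, -map_neg] at this
      exact hr this)
  rw [← MulEquiv.irreducible_iff e]
  convert key using 1
  simp only [map_add, map_sub, map_mul, map_pow, map_neg, eX0, eX1, eC]
  ring
end
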